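/- arXiv:1409.3768 — 9 statements merged into one kernel-verified Lean document; each statement's English description precedes it below -/
import Mathlib

section
/- For a symmetric p×p real matrix Ω with positive diagonal entries, the CONCORD objective in regression form equals its matrix form: −Σ_{i=1}^p n log ω_ii + (1/2) Σ_{i=1}^p ‖ω_ii Y_i + Σ_{j≠i} ω_ij Y_j‖₂² + nλ Σ_{1≤i<j≤p} |ω_ij| = (n/2)[ −log det(Ω_D²) + tr(S Ω²) + λ Σ_{i≠j} |ω_ij| ], where S = (1/n)YᵀY and Ω_D is the diagonal part of Ω. -/
open Finset Matrix

/-- For a symmetric function, the sum over ordered off-diagonal pairs is twice the sum over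
increasing pairs. -/
theorem sum_offDiag_eq_two_mul_sum_lt {ι R : Type*} [Fintype ι] [LinearOrder ι]
    [NonAssocSemiring R] (f : ι → ι → R) (hf : ∀ i j, f i j = f j i) :
    ∑ i, ∑ j ∈ Finset.univ.filter (fun j => j ≠ i), f i j
      = 2 * ∑ i, ∑ j ∈ Finset.univ.filter (fun j => i < j), f i j := by
  have hsplit : ∀ i, ∑ j ∈ Finset.univ.filter (fun j => j ≠ i), f i j
      = (∑ j, if i < j then f i j else 0) + ∑ j, if j < i then f j i else 0 := fun i => by
    rw [Finset.sum_filter, ← Finset.sum_add_distrib]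
    refine Finset.sum_congr rfl fun j _ => ?_
    rcases lt_trichotomy i j with h | h | h
    · simp [h, h.ne', h.not_gt]
    · simp [h]
    · simp [h, h.ne, h.not_gt, hf i j]
  simp_rw [hsplit, Finset.sum_add_distrib, Finset.sum_filter]
  rw [Finset.sum_comm (f := fun i j => if j < i then f j i else 0), two_mul]

/-- The sum of the squared entries of `A` is the trace of `Aᵀ * A`. -/
theorem sum_sum_sq_eq_trace_transpose_mul_self {m n R : Type*} [Fintype m] [Fintype n]
    [CommSemiring R] (A : Matrix m n R) :
    ∑ i, ∑ k, A k i ^ 2 = (Aᵀ * A).trace := by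
  simp [Matrix.trace, Matrix.mul_apply, sq]

/-- The log-determinant of the square of a diagonal matrix with nonzero diagonal. -/
theorem log_det_diagonal_mul_diagonal {ι : Type*} [Fintype ι] [DecidableEq ι] {d : ι → ℝ}
    (hd : ∀ i, d i ≠ 0) :
    Real.log (Matrix.diagonal d * Matrix.diagonal d).det = 2 * ∑ i, Real.log (d i) := by
  rw [Matrix.det_mul, Matrix.det_diagonal, ← sq, Real.log_pow,
    Real.log_prod fun i _ => hd i]
  norm_num

/-- For symmetric `Ω`, the regression residual of the `i`-th column is the `i`-th column of
`Y * Ω`. -/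
theorem add_sum_ne_eq_mul_apply {m ι R : Type*} [Fintype ι] [DecidableEq ι]
    [CommSemiring R] (Y : Matrix m ι R) {Ω : Matrix ι ι R} (hΩ : Ω.IsSymm) (i : ι) (k : m) :
    Ω i i * Y k i + ∑ j ∈ Finset.univ.filter (fun j => j ≠ i), Ω i j * Y k j
      = (Y * Ω) k i := by
  rw [Finset.filter_ne', Finset.add_sum_erase _ (fun j => Ω i j * Y k j) (Finset.mem_univ i),
    Matrix.mul_apply]
  exact Finset.sum_congr rfl fun j _ => by rw [hΩ.apply j i, mul_comm]

/-- For a symmetric p×p real matrix Ω with positive diagonal entries,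
the CONCORD objective in regression form equals its matrix form. -/
theorem concord_regression_form_eq_matrix_form
    {n p : ℕ} (hn : 0 < n) (Y : Matrix (Fin n) (Fin p) ℝ)
    (lam : ℝ) (hlam : 0 < lam)
    (S : Matrix (Fin p) (Fin p) ℝ) (hS : S = (n : ℝ)⁻¹ • (Yᵀ * Y))
    (Ω : Matrix (Fin p) (Fin p) ℝ) (hΩ : Ω.IsSymm) (hdiag : ∀ i, 0 < Ω i i) :
    (-(∑ i, (n : ℝ) * Real.log (Ω i i))
        + (1 / 2) * ∑ i, ∑ k,
            (Ω i i * Y k i + ∑ j ∈ Finset.univ.filter (fun j => j ≠ i), Ω i j * Y k j) ^ 2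
        + (n : ℝ) * lam * ∑ i, ∑ j ∈ Finset.univ.filter (fun j => i < j), |Ω i j|)
      = ((n : ℝ) / 2) *
          (-(Real.log ((Matrix.diagonal (fun i => Ω i i)
                * Matrix.diagonal (fun i => Ω i i)).det))
            + (S * (Ω * Ω)).trace
            + lam * ∑ i, ∑ j ∈ Finset.univ.filter (fun j => j ≠ i), |Ω i j|) := by
  have hn0 : (n : ℝ) ≠ 0 := by positivity
  have htrace : ((Y * Ω)ᵀ * (Y * Ω)).trace = (n : ℝ) * (S * (Ω * Ω)).trace := by
    rw [hS, Matrix.smul_mul, Matrix.trace_smul, smul_eq_mul, mul_inv_cancel_left₀ hn0,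
      Matrix.transpose_mul, hΩ.eq, Matrix.mul_assoc, Matrix.trace_mul_comm]
    simp only [Matrix.mul_assoc]
  rw [log_det_diagonal_mul_diagonal fun i => (hdiag i).ne',
    sum_offDiag_eq_two_mul_sum_lt (fun i j => |Ω i j|) fun i j => by rw [hΩ.apply i j]]
  simp_rw [add_sum_ne_eq_mul_apply Y hΩ]
  rw [sum_sum_sq_eq_trace_transpose_mul_self, htrace, ← Finset.mul_sum]
  ring
end

section
/- Fix indices i < j with s_ii + s_jj > 0, and hold all entries of the symmetric matrix Ω fixed except the pair ω_ij = ω_ji. Then the unique minimizer of the CONCORD objective Q_con as a function of ω_ij is given by the closed form ω_ij = S_λ( −( Σ_{j'≠j} ω_ij' s_jj' + Σ_{i'≠i} ω_i'j s_ii' ) ) / (s_ii + s_jj), where the sums range over j' ≠ j and i' ≠ i respectively (with the current values of the other entries of Ω). -/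
open Finset Matrix

/-- The soft-thresholding operator `S_λ(x) = sign(x) · max(|x| − λ, 0)`. -/
noncomputable def softThresh (lam x : ℝ) : ℝ := Real.sign x * max (|x| - lam) 0

/-- The CONCORD objective in regression form. -/
noncomputable def Qcon {n p : ℕ} (Y : Matrix (Fin n) (Fin p) ℝ) (lam : ℝ)
    (Ω : Matrix (Fin p) (Fin p) ℝ) : ℝ :=
  -(∑ i, (n : ℝ) * Real.log (Ω i i))
    + (1 / 2) * ∑ i, ∑ k,
        (Ω i i * Y k i + ∑ j ∈ Finset.univ.filter (fun j => j ≠ i), Ω i j * Y k j) ^ 2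
    + (n : ℝ) * lam * ∑ i, ∑ j ∈ Finset.univ.filter (fun j => i < j), |Ω i j|

/-- The matrix obtained from `Ω` by replacing the symmetric pair of entries
`ω_ij = ω_ji` by `t`, holding all other entries fixed. -/
def updOffdiag {p : ℕ} (Ω : Matrix (Fin p) (Fin p) ℝ) (i j : Fin p) (t : ℝ) :
    Matrix (Fin p) (Fin p) ℝ :=
  Matrix.of fun a b => if (a = i ∧ b = j) ∨ (a = j ∧ b = i) then t else Ω a b

/-- `softThresh lam b` is the unique minimizer of the scaled scalar lasso objective,
with a quadratic growth bound. -/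
theorem lasso_quadratic_growth {a lam : ℝ} (ha : 0 < a) (hlam : 0 < lam) (b t : ℝ) :
    a / 2 * (softThresh lam b / a) ^ 2 - b * (softThresh lam b / a)
        + lam * |softThresh lam b / a| + a / 2 * (t - softThresh lam b / a) ^ 2
      ≤ a / 2 * t ^ 2 - b * t + lam * |t| := by
  obtain ⟨u, hu⟩ : ∃ u, u = softThresh lam b / a := ⟨_, rfl⟩
  have hau : a * u = softThresh lam b := by rw [hu]; field_simp
  rw [← hu]
  -- the subgradient inequality at the minimizer
  suffices h : lam * |u| + (b - a * u) * (t - u) ≤ lam * |t| by nlinarith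
  have ht1 := mul_le_mul_of_nonneg_left (le_abs_self t) hlam.le
  have ht2 := mul_le_mul_of_nonneg_left (neg_abs_le t) hlam.le
  rcases le_or_gt |b| lam with hb | hb
  · have hu0 : u = 0 := by
      rw [hu, softThresh, max_eq_right (by linarith)]; simp
    have : b * t ≤ lam * |t| := by
      calc b * t ≤ |b * t| := le_abs_self _
        _ = |b| * |t| := abs_mul b t
        _ ≤ lam * |t| := by gcongr
    simpa [hu0] using this
  · rw [softThresh, max_eq_left (by linarith)] at hau
    rcases lt_abs.mp hb with hb' | hb'
    · have hb0 : 0 < b := hlam.trans hb'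
      rw [Real.sign_of_pos hb0, abs_of_pos hb0, one_mul] at hau
      have hu_pos : 0 < u := by
        by_contra! h
        nlinarith
      rw [abs_of_pos hu_pos, hau]
      linarith
    · have hb0 : b < 0 := by linarith
      rw [Real.sign_of_neg hb0, abs_of_neg hb0] at hau
      have hu_neg : u < 0 := by
        by_contra! h
        nlinarith
      rw [abs_of_neg hu_neg, hau]
      linarith

/-- The regression residual in `Qcon` is a full row sum. -/
theorem diag_add_sum_ne {p : ℕ} (Ω : Matrix (Fin p) (Fin p) ℝ) (y : Fin p → ℝ) (i : Fin p) :
    Ω i i * y i + ∑ j ∈ Finset.univ.filter (fun j => j ≠ i), Ω i j * y j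
      = ∑ j, Ω i j * y j := by
  rw [Finset.filter_ne', Finset.add_sum_erase _ (fun j => Ω i j * y j) (Finset.mem_univ i)]

theorem sum_updOffdiag_mul {p : ℕ} (Ω : Matrix (Fin p) (Fin p) ℝ) {i j : Fin p} (hij : i ≠ j)
    (t : ℝ) (y : Fin p → ℝ) (a : Fin p) :
    ∑ b, updOffdiag Ω i j t a b * y b
      = ∑ b, updOffdiag Ω i j 0 a b * y b
        + t * ((if a = i then y j else 0) + (if a = j then y i else 0)) := by
  have h : ∀ b, updOffdiag Ω i j t a b * y b = updOffdiag Ω i j 0 a b * y b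
      + t * ((if b = j then (if a = i then y j else 0) else 0)
        + (if b = i then (if a = j then y i else 0) else 0)) := by
    intro b
    simp only [updOffdiag, Matrix.of_apply]
    by_cases h1 : a = i <;> by_cases h2 : b = j <;> by_cases h3 : a = j <;>
      by_cases h4 : b = i <;> grind
  simp only [h, Finset.sum_add_distrib, ← Finset.mul_sum, Finset.sum_ite_eq', Finset.mem_univ,
    if_true]

theorem sum_sq_add_two_ite {n p : ℕ} (R : Fin p → Fin n → ℝ) (u v : Fin n → ℝ) {i j : Fin p}
    (hij : i ≠ j) (t : ℝ) :
    ∑ a, ∑ k, (R a k + t * ((if a = i then u k else 0) + (if a = j then v k else 0))) ^ 2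
      = ∑ a, ∑ k, R a k ^ 2 + 2 * t * (∑ k, u k * R i k + ∑ k, v k * R j k)
        + t ^ 2 * (∑ k, u k * u k + ∑ k, v k * v k) := by
  have h : ∀ a, ∑ k, (R a k + t * ((if a = i then u k else 0) + (if a = j then v k else 0))) ^ 2
      = ∑ k, R a k ^ 2
        + ((if a = i then 2 * t * ∑ k, u k * R i k + t ^ 2 * ∑ k, u k * u k else 0)
          + (if a = j then 2 * t * ∑ k, v k * R j k + t ^ 2 * ∑ k, v k * v k else 0)) := by
    intro a
    by_cases h1 : a = i
    · subst h1
      simp only [if_true, if_neg hij, add_zero, Finset.mul_sum, ← Finset.sum_add_distrib]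
      exact Finset.sum_congr rfl fun k _ => by ring
    · by_cases h2 : a = j
      · subst h2
        simp only [if_true, if_neg h1, zero_add, Finset.mul_sum, ← Finset.sum_add_distrib]
        exact Finset.sum_congr rfl fun k _ => by ring
      · simp [h1, h2]
  simp only [h, Finset.sum_add_distrib, Finset.sum_ite_eq', Finset.mem_univ, if_true]
  ring

theorem sum_abs_updOffdiag {p : ℕ} (Ω : Matrix (Fin p) (Fin p) ℝ) {i j : Fin p} (hij : i < j) (t : ℝ) :
    ∑ a, ∑ b ∈ Finset.univ.filter (fun b => a < b), |updOffdiag Ω i j t a b|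
      = ∑ a, ∑ b ∈ Finset.univ.filter (fun b => a < b), |updOffdiag Ω i j 0 a b| + |t| := by
  have h : ∀ a, ∑ b ∈ Finset.univ.filter (fun b => a < b), |updOffdiag Ω i j t a b|
      = ∑ b ∈ Finset.univ.filter (fun b => a < b), |updOffdiag Ω i j 0 a b|
        + if a = i then |t| else 0 := by
    intro a
    have h' : ∀ b ∈ Finset.univ.filter (fun b => a < b), |updOffdiag Ω i j t a b|
        = |updOffdiag Ω i j 0 a b| + if b = j then (if a = i then |t| else 0) else 0 := by
      intro b hb
      have hab : a < b := (Finset.mem_filter.mp hb).2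
      have hne : ¬ (a = j ∧ b = i) := by
        rintro ⟨rfl, rfl⟩
        exact lt_asymm hij hab
      simp only [updOffdiag, Matrix.of_apply, hne, or_false]
      by_cases h1 : a = i <;> by_cases h2 : b = j <;> simp [h1, h2]
    rw [Finset.sum_congr rfl h', Finset.sum_add_distrib, Finset.sum_ite_eq']
    by_cases h1 : a = i
    · subst h1; simp [hij]
    · simp [h1]
  simp only [h, Finset.sum_add_distrib, Finset.sum_ite_eq', Finset.mem_univ, if_true]

theorem updOffdiag_diag {p : ℕ} (Ω : Matrix (Fin p) (Fin p) ℝ) {i j : Fin p} (hij : i ≠ j) (t : ℝ)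
    (a : Fin p) : updOffdiag Ω i j t a a = Ω a a := by
  simp only [updOffdiag, Matrix.of_apply]
  grind

/-- Row `i` with its entry `j` zeroed, as a sum over the remaining indices. -/
theorem sum_updOffdiag_zero_left {p : ℕ} (Ω : Matrix (Fin p) (Fin p) ℝ) {i j : Fin p} (hij : i ≠ j)
    (y : Fin p → ℝ) :
    ∑ b, updOffdiag Ω i j 0 i b * y b
      = ∑ b ∈ Finset.univ.filter (fun b => b ≠ j), Ω i b * y b := by
  rw [Finset.sum_filter]
  refine Finset.sum_congr rfl fun b _ => ?_
  by_cases h : b = j <;> simp [updOffdiag, h, hij]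

theorem updOffdiag_comm {p : ℕ} (Ω : Matrix (Fin p) (Fin p) ℝ) (i j : Fin p) (t : ℝ) :
    updOffdiag Ω i j t = updOffdiag Ω j i t := by
  ext a b
  simp only [updOffdiag, Matrix.of_apply, or_comm]

theorem natCast_mul_gram_apply {n p : ℕ} (hn : 0 < n) (Y : Matrix (Fin n) (Fin p) ℝ) (a b : Fin p) :
    (n : ℝ) * ((n : ℝ)⁻¹ • (Yᵀ * Y)) a b = ∑ k, Y k a * Y k b := by
  have : (n : ℝ) ≠ 0 := by positivity
  simp [Matrix.mul_apply, this]

theorem sum_mul_sum_filter_ne {n p : ℕ} (hn : 0 < n) (Y : Matrix (Fin n) (Fin p) ℝ) (w : Fin p → ℝ)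
    (j : Fin p) :
    ∑ k, Y k j * ∑ b ∈ Finset.univ.filter (fun b => b ≠ j), w b * Y k b
      = n * ∑ b ∈ Finset.univ.filter (fun b => b ≠ j),
          w b * ((n : ℝ)⁻¹ • (Yᵀ * Y)) j b := by
  have h : ∀ b, (n : ℝ) * (w b * ((n : ℝ)⁻¹ • (Yᵀ * Y)) j b) = ∑ k, Y k j * (w b * Y k b) := by
    intro b
    rw [mul_left_comm, natCast_mul_gram_apply hn, Finset.mul_sum]
    exact Finset.sum_congr rfl fun k _ => by ring
  simp only [Finset.mul_sum, h]
  exact Finset.sum_comm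

/-- As a function of one off-diagonal pair, the CONCORD objective is a scalar lasso objective. -/
theorem Qcon_updOffdiag {n p : ℕ} (hn : 0 < n) (Y : Matrix (Fin n) (Fin p) ℝ) (lam : ℝ)
    {S : Matrix (Fin p) (Fin p) ℝ} (hS : S = (n : ℝ)⁻¹ • (Yᵀ * Y))
    {Ω : Matrix (Fin p) (Fin p) ℝ} (hΩ : Ω.IsSymm) {i j : Fin p} (hij : i < j) (t : ℝ) :
    Qcon Y lam (updOffdiag Ω i j t) = Qcon Y lam (updOffdiag Ω i j 0)
      + n * ((S i i + S j j) / 2 * t ^ 2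
        - -((∑ j' ∈ Finset.univ.filter (fun j' => j' ≠ j), Ω i j' * S j j')
            + (∑ i' ∈ Finset.univ.filter (fun i' => i' ≠ i), Ω i' j * S i i')) * t
        + lam * |t|) := by
  have hsymm : ∀ b, Ω b j = Ω j b := fun b => hΩ.apply j b
  have hrow_j : ∀ y : Fin p → ℝ, ∑ b, updOffdiag Ω i j 0 j b * y b
      = ∑ b ∈ Finset.univ.filter (fun b => b ≠ i), Ω j b * y b := fun y => by
    rw [updOffdiag_comm, sum_updOffdiag_zero_left Ω hij.ne']
  simp only [Qcon, updOffdiag_diag Ω hij.ne, sum_abs_updOffdiag Ω hij t]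
  have hres : ∀ (s : ℝ) (a : Fin p) (k : Fin n),
      Ω a a * Y k a + ∑ b ∈ Finset.univ.filter (fun b => b ≠ a), updOffdiag Ω i j s a b * Y k b
        = ∑ b, updOffdiag Ω i j s a b * Y k b := fun s a k => by
    rw [← diag_add_sum_ne, updOffdiag_diag Ω hij.ne]
  simp only [hres]
  have hsq := sum_sq_add_two_ite (fun a k => ∑ b, updOffdiag Ω i j 0 a b * Y k b)
    (fun k => Y k j) (fun k => Y k i) hij.ne t
  simp only [← sum_updOffdiag_mul Ω hij.ne t (Y _)] at hsq
  rw [hsq]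
  simp only [sum_updOffdiag_zero_left Ω hij.ne, hrow_j, sum_mul_sum_filter_ne hn, hsymm,
    ← natCast_mul_gram_apply hn, ← hS]
  ring

/-- for fixed `i < j` with `s_ii + s_jj > 0`, holding all other entries of the
symmetric matrix `Ω` fixed, the unique minimizer of the CONCORD objective as a function of
`ω_ij = ω_ji` is `S_λ(−(Σ_{j'≠j} ω_ij' s_jj' + Σ_{i'≠i} ω_i'j s_ii'))/(s_ii + s_jj)`. -/
theorem concord_offdiagonal_coordinate_update
    {n p : ℕ} (hn : 0 < n) (Y : Matrix (Fin n) (Fin p) ℝ)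
    (lam : ℝ) (hlam : 0 < lam)
    (S : Matrix (Fin p) (Fin p) ℝ) (hS : S = (n : ℝ)⁻¹ • (Yᵀ * Y))
    (Ω : Matrix (Fin p) (Fin p) ℝ) (hΩ : Ω.IsSymm) (hdiag : ∀ k, 0 < Ω k k)
    (i j : Fin p) (hij : i < j) (hpos : 0 < S i i + S j j)
    (tstar : ℝ)
    (htstar : tstar =
      softThresh lam
          (-((∑ j' ∈ Finset.univ.filter (fun j' => j' ≠ j), Ω i j' * S j j')
            + (∑ i' ∈ Finset.univ.filter (fun i' => i' ≠ i), Ω i' j * S i i')))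
        / (S i i + S j j)) :
    (∀ t : ℝ, Qcon Y lam (updOffdiag Ω i j tstar) ≤ Qcon Y lam (updOffdiag Ω i j t)) ∧
    (∀ t : ℝ, t ≠ tstar →
      Qcon Y lam (updOffdiag Ω i j tstar) < Qcon Y lam (updOffdiag Ω i j t)) := by
  have hn' : (0 : ℝ) < n := by exact_mod_cast hn
  have hgap : ∀ t : ℝ, Qcon Y lam (updOffdiag Ω i j tstar)
      + n * ((S i i + S j j) / 2 * (t - tstar) ^ 2) ≤ Qcon Y lam (updOffdiag Ω i j t) := by
    intro t
    rw [Qcon_updOffdiag hn Y lam hS hΩ hij t, Qcon_updOffdiag hn Y lam hS hΩ hij tstar]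
    have h := mul_le_mul_of_nonneg_left (lasso_quadratic_growth hpos hlam
      (-((∑ j' ∈ Finset.univ.filter (fun j' => j' ≠ j), Ω i j' * S j j')
        + (∑ i' ∈ Finset.univ.filter (fun i' => i' ≠ i), Ω i' j * S i i'))) t) hn'.le
    rw [← htstar] at h
    linarith
  refine ⟨fun t => le_trans (le_add_of_nonneg_right (by positivity)) (hgap t), fun t ht => ?_⟩
  have hne : t - tstar ≠ 0 := sub_ne_zero.mpr ht
  exact lt_of_lt_of_le (lt_add_of_pos_right _ (by positivity)) (hgap t)
end

section
/- Fix an index i with s_ii > 0, and hold all entries of the symmetric matrix Ω fixed except the diagonal entry ω_ii. Then the unique minimizer over ω_ii > 0 of the CONCORD objective Q_con as a function of ω_ii is ω_ii = [ −Σ_{j≠i} ω_ij s_ij + √( (Σ_{j≠i} ω_ij s_ij)² + 4 s_ii ) ] / (2 s_ii). -/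
open Finset Matrix

/-- The matrix obtained from `Ω` by replacing the diagonal entry `ω_ii` by `t`,
holding all other entries fixed. -/
def updDiag {p : ℕ} (Ω : Matrix (Fin p) (Fin p) ℝ) (i : Fin p) (t : ℝ) :
    Matrix (Fin p) (Fin p) ℝ :=
  Matrix.of fun a b => if a = i ∧ b = i then t else Ω a b

/-- Off the diagonal entry `ω_ii`, `updDiag` agrees with `Ω`. -/
lemma updDiag_apply_of_not {p : ℕ} (Ω : Matrix (Fin p) (Fin p) ℝ) (i : Fin p) (t : ℝ)
    {a b : Fin p} (h : ¬(a = i ∧ b = i)) : updDiag Ω i t a b = Ω a b := by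
  simp [updDiag, h]

lemma updDiag_apply_self {p : ℕ} (Ω : Matrix (Fin p) (Fin p) ℝ) (i : Fin p) (t : ℝ) :
    updDiag Ω i t i i = t := by
  simp [updDiag]

/-- As a function of one diagonal entry, the CONCORD objective is a constant plus a multiple of
`-log t + s_ii t² / 2 + B t`. -/
lemma exists_Qcon_updDiag_eq {n p : ℕ} (hn : 0 < n) (Y : Matrix (Fin n) (Fin p) ℝ) (lam : ℝ)
    (Ω S : Matrix (Fin p) (Fin p) ℝ) (hS : S = (n : ℝ)⁻¹ • (Yᵀ * Y)) (i : Fin p) :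
    ∃ C : ℝ, ∀ t : ℝ, Qcon Y lam (updDiag Ω i t) =
      C + n * (-Real.log t + S i i * t ^ 2 / 2
        + (∑ j ∈ Finset.univ.filter (fun j => j ≠ i), Ω i j * S i j) * t) := by
  have hn' : (n : ℝ) ≠ 0 := by positivity
  set r : Fin n → ℝ := fun k => ∑ j ∈ Finset.univ.filter (fun j => j ≠ i), Ω i j * Y k j with hr
  have hSij (j : Fin p) : n * S i j = ∑ k, Y k i * Y k j := by
    simp [hS, Matrix.mul_apply, mul_inv_cancel_left₀ hn']
  have hcross : n * ∑ j ∈ Finset.univ.filter (fun j => j ≠ i), Ω i j * S i j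
      = ∑ k, Y k i * r k := by
    simp only [hr, Finset.mul_sum]
    rw [Finset.sum_comm]
    refine Finset.sum_congr rfl fun j _ => ?_
    rw [mul_left_comm, hSij, Finset.mul_sum]
    exact Finset.sum_congr rfl fun k _ => by ring
  refine ⟨-(∑ a ∈ Finset.univ.erase i, (n : ℝ) * Real.log (Ω a a))
    + (1 / 2) * (∑ k, r k ^ 2 + ∑ a ∈ Finset.univ.erase i, ∑ k,
        (Ω a a * Y k a + ∑ j ∈ Finset.univ.filter (fun j => j ≠ a), Ω a j * Y k j) ^ 2)
    + (n : ℝ) * lam * ∑ a, ∑ j ∈ Finset.univ.filter (fun j => a < j), |Ω a j|, fun t => ?_⟩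
  have hoff (a : Fin p) (k : Fin n) :
      ∑ j ∈ Finset.univ.filter (fun j => j ≠ a), updDiag Ω i t a j * Y k j
        = ∑ j ∈ Finset.univ.filter (fun j => j ≠ a), Ω a j * Y k j := by
    refine Finset.sum_congr rfl fun j hj => ?_
    rw [updDiag_apply_of_not]
    rintro ⟨rfl, rfl⟩
    simp at hj
  have hpen : ∑ a, ∑ j ∈ Finset.univ.filter (fun j => a < j), |updDiag Ω i t a j|
      = ∑ a, ∑ j ∈ Finset.univ.filter (fun j => a < j), |Ω a j| := by
    refine Finset.sum_congr rfl fun a _ => Finset.sum_congr rfl fun j hj => ?_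
    rw [updDiag_apply_of_not]
    rintro ⟨rfl, rfl⟩
    simp at hj
  have hdiag {a : Fin p} (ha : a ∈ Finset.univ.erase i) : updDiag Ω i t a a = Ω a a :=
    updDiag_apply_of_not _ _ _ fun h => (Finset.mem_erase.1 ha).1 h.1
  have hlog : ∑ a, (n : ℝ) * Real.log (updDiag Ω i t a a)
      = n * Real.log t + ∑ a ∈ Finset.univ.erase i, (n : ℝ) * Real.log (Ω a a) := by
    rw [← Finset.add_sum_erase _ _ (Finset.mem_univ i), updDiag_apply_self]
    exact congrArg _ (Finset.sum_congr rfl fun a ha => by rw [hdiag ha])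
  have hrow : ∑ k, (t * Y k i + r k) ^ 2
      = n * S i i * t ^ 2 + 2 * t * ∑ k, Y k i * r k + ∑ k, r k ^ 2 := by
    rw [hSij, Finset.sum_mul, Finset.mul_sum, ← Finset.sum_add_distrib, ← Finset.sum_add_distrib]
    exact Finset.sum_congr rfl fun k _ => by ring
  have hquad : ∑ a, ∑ k, (updDiag Ω i t a a * Y k a
        + ∑ j ∈ Finset.univ.filter (fun j => j ≠ a), Ω a j * Y k j) ^ 2
      = ∑ k, (t * Y k i + r k) ^ 2 + ∑ a ∈ Finset.univ.erase i, ∑ k,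
        (Ω a a * Y k a + ∑ j ∈ Finset.univ.filter (fun j => j ≠ a), Ω a j * Y k j) ^ 2 := by
    rw [← Finset.add_sum_erase _ _ (Finset.mem_univ i), updDiag_apply_self]
    exact congrArg _ (Finset.sum_congr rfl fun a ha => by rw [hdiag ha])
  simp only [Qcon, hoff]
  rw [hpen, hlog, hquad, hrow, ← hcross]
  ring

/-- A positive critical point of `-log t + s t² / 2 + B t` is its strict minimizer. -/
lemma neg_log_add_quadratic_lt {s B u t : ℝ} (hs : 0 ≤ s) (hu : 0 < u) (ht : 0 < t)
    (hcrit : s * u ^ 2 + B * u = 1) (hne : t ≠ u) :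
    -Real.log u + s * u ^ 2 / 2 + B * u < -Real.log t + s * t ^ 2 / 2 + B * t := by
  have hlog := Real.log_lt_sub_one_of_pos (div_pos ht hu) (by rwa [Ne, div_eq_one_iff_eq hu.ne'])
  rw [Real.log_div ht.ne' hu.ne'] at hlog
  have hdiv : t / u = (s * u + B) * t := by
    rw [div_eq_iff hu.ne']
    linear_combination -t * hcrit
  nlinarith [mul_nonneg hs (sq_nonneg (t - u))]

/-- The positive root of `s u² + B u = 1`. -/
lemma quadratic_pos_root {s B u : ℝ} (hs : 0 < s)
    (hu : u = (-B + Real.sqrt (B ^ 2 + 4 * s)) / (2 * s)) :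
    0 < u ∧ s * u ^ 2 + B * u = 1 := by
  have hsq : Real.sqrt (B ^ 2 + 4 * s) ^ 2 = B ^ 2 + 4 * s := Real.sq_sqrt (by positivity)
  have hlt : B < Real.sqrt (B ^ 2 + 4 * s) := Real.lt_sqrt_of_sq_lt (by linarith)
  generalize Real.sqrt (B ^ 2 + 4 * s) = r at hu hsq hlt
  subst hu
  refine ⟨div_pos (by linarith) (by linarith), ?_⟩
  field_simp
  linear_combination hsq

/-- for a fixed index `i` with `s_ii > 0`, holding all other entries of the
symmetric matrix `Ω` fixed, the unique minimizer over `ω_ii > 0` of the CONCORD objective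
as a function of `ω_ii` is
`(−Σ_{j≠i} ω_ij s_ij + √((Σ_{j≠i} ω_ij s_ij)² + 4 s_ii)) / (2 s_ii)`. -/
theorem concord_diagonal_coordinate_update
    {n p : ℕ} (hn : 0 < n) (Y : Matrix (Fin n) (Fin p) ℝ)
    (lam : ℝ) (hlam : 0 < lam)
    (S : Matrix (Fin p) (Fin p) ℝ) (hS : S = (n : ℝ)⁻¹ • (Yᵀ * Y))
    (Ω : Matrix (Fin p) (Fin p) ℝ) (hΩ : Ω.IsSymm) (hdiag : ∀ k, 0 < Ω k k)
    (i : Fin p) (hpos : 0 < S i i)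
    (B : ℝ) (hB : B = ∑ j ∈ Finset.univ.filter (fun j => j ≠ i), Ω i j * S i j)
    (tstar : ℝ) (htstar : tstar = (-B + Real.sqrt (B ^ 2 + 4 * S i i)) / (2 * S i i)) :
    0 < tstar ∧
    (∀ t : ℝ, 0 < t → Qcon Y lam (updDiag Ω i tstar) ≤ Qcon Y lam (updDiag Ω i t)) ∧
    (∀ t : ℝ, 0 < t → t ≠ tstar →
      Qcon Y lam (updDiag Ω i tstar) < Qcon Y lam (updDiag Ω i t)) := by
  obtain ⟨ht, hcrit⟩ := quadratic_pos_root hpos htstar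
  obtain ⟨C, hC⟩ := exists_Qcon_updDiag_eq hn Y lam Ω S hS i
  have hlt (t : ℝ) (h0 : 0 < t) (hne : t ≠ tstar) :
      Qcon Y lam (updDiag Ω i tstar) < Qcon Y lam (updDiag Ω i t) := by
    rw [hC, hC, ← hB]
    have := neg_log_add_quadratic_lt hpos.le ht h0 hcrit hne
    gcongr
  refine ⟨ht, fun t h0 => ?_, hlt⟩
  rcases eq_or_ne t tstar with rfl | hne
  · exact le_rfl
  · exact (hlt t h0 hne).le
end

section
/- (Theorem 1, upper bound.) Suppose S is positive semidefinite with all diagonal entries s_kk > 0. Then for every M ∈ ℝ there exists a constant b = b_{M,λ,S} > 0 (depending only on M, λ and S) such that every symmetric matrix Ω with all diagonal entries nonzero and Q(Ω) ≤ M satisfies |ω_kk| ≤ b for all k = 1,…,p. -/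
open Finset Matrix

/-- The smooth part of the CONCORD objective:
`h1(Ω) = −Σ_i log|ω_ii| + (1/2) tr(ΩSΩ)`. -/
noncomputable def h1 {p : ℕ} (S Ω : Matrix (Fin p) (Fin p) ℝ) : ℝ :=
  -(∑ i, Real.log |Ω i i|) + (1 / 2) * (Ω * S * Ω).trace

/-- The nonsmooth part of the CONCORD objective: `h2(Ω) = λ Σ_{i≠j} |ω_ij|`. -/
noncomputable def h2 {p : ℕ} (lam : ℝ) (Ω : Matrix (Fin p) (Fin p) ℝ) : ℝ :=
  lam * ∑ i, ∑ j ∈ Finset.univ.filter (fun j => j ≠ i), |Ω i j|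

/-- The CONCORD objective `Q = h1 + h2`. -/
noncomputable def Qobj {p : ℕ} (S : Matrix (Fin p) (Fin p) ℝ) (lam : ℝ)
    (Ω : Matrix (Fin p) (Fin p) ℝ) : ℝ :=
  h1 S Ω + h2 lam Ω

/-- Tangent-plane lower bound for a positive semidefinite quadratic form with an `ℓ¹` penalty. -/
theorem linear_le_quadratic_add_l1 {p : ℕ} {S : Matrix (Fin p) (Fin p) ℝ} (hS : S.PosSemidef)
    {C t : ℝ} (ht : 0 ≤ t) (i : Fin p) (hC : ∀ j, |S i j| ≤ C) (x : Fin p → ℝ) :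
    t * S i i * |x i| - t ^ 2 * S i i / 2 ≤
      1 / 2 * (x ⬝ᵥ S *ᵥ x) + t * C * ∑ j ∈ univ.filter (fun j => j ≠ i), |x j| := by
  obtain ⟨σ, hσ, hx⟩ : ∃ σ : ℝ, |σ| = 1 ∧ σ * x i = |x i| := by
    rcases le_total 0 (x i) with h | h
    · exact ⟨1, by simp, by simp [abs_of_nonneg h]⟩
    · exact ⟨-1, by simp, by simp [abs_of_nonpos h]⟩
  have hσ2 : σ ^ 2 = 1 := by rw [← sq_abs, hσ, one_pow]
  have hsymm : x ⬝ᵥ S *ᵥ Pi.single i 1 = (S *ᵥ x) i := by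
    have hT : Sᵀ = S := by simpa using hS.isHermitian.eq
    rw [dotProduct_mulVec, ← mulVec_transpose, hT, dotProduct_single_one]
  have hquad := hS.dotProduct_mulVec_nonneg (x - (t * σ) • Pi.single i 1)
  have hexp : (x - (t * σ) • Pi.single i 1) ⬝ᵥ S *ᵥ (x - (t * σ) • Pi.single i 1) =
      x ⬝ᵥ S *ᵥ x - 2 * t * (σ * (S *ᵥ x) i) + t ^ 2 * S i i := by
    have hii : (Pi.single i 1 : Fin p → ℝ) ⬝ᵥ S *ᵥ Pi.single i 1 = S i i := by simp
    have hi : (Pi.single i 1 : Fin p → ℝ) ⬝ᵥ S *ᵥ x = (S *ᵥ x) i := by simp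
    simp only [mulVec_sub, mulVec_smul, sub_dotProduct, dotProduct_sub, smul_dotProduct,
      dotProduct_smul, hsymm, hii, hi, smul_eq_mul]
    linear_combination t ^ 2 * S i i * hσ2
  rw [star_trivial, hexp] at hquad
  have hrow : S i i * |x i| - C * ∑ j ∈ univ.filter (fun j => j ≠ i), |x j| ≤
      σ * (S *ᵥ x) i := by
    have hsplit : σ * (S *ᵥ x) i =
        S i i * |x i| + ∑ j ∈ univ.filter (fun j => j ≠ i), σ * (S i j * x j) := by
      rw [← hx, mulVec, dotProduct, Finset.mul_sum, ← Finset.add_sum_erase _ _ (mem_univ i),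
        Finset.filter_ne']
      ring
    have hoff : -∑ j ∈ univ.filter (fun j => j ≠ i), C * |x j| ≤
        ∑ j ∈ univ.filter (fun j => j ≠ i), σ * (S i j * x j) := by
      rw [← Finset.sum_neg_distrib]
      refine Finset.sum_le_sum fun j _ => ?_
      refine (neg_le_neg ?_).trans (neg_abs_le _)
      rw [abs_mul, abs_mul, hσ, one_mul]
      exact mul_le_mul_of_nonneg_right (hC j) (abs_nonneg _)
    rw [hsplit, Finset.mul_sum]
    linarith
  nlinarith [mul_le_mul_of_nonneg_left hrow ht]

theorem trace_mul_mul_of_isSymm {p : ℕ} {S Ω : Matrix (Fin p) (Fin p) ℝ} (hΩ : Ω.IsSymm) :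
    (Ω * S * Ω).trace = ∑ i, Ω i ⬝ᵥ S *ᵥ Ω i := by
  refine Finset.sum_congr rfl fun i _ => ?_
  have hcol : (fun j => Ω j i) = Ω i := funext fun j => hΩ.apply i j
  rw [Matrix.diag_apply, Matrix.mul_assoc, Matrix.mul_apply]
  refine Finset.sum_congr rfl fun j _ => ?_
  rw [Matrix.mul_apply, mulVec, dotProduct]
  simp only [congrFun hcol]

theorem log_le_half_mul_add {a d : ℝ} (ha : 0 < a) (hd : 0 < d) :
    Real.log d ≤ a / 2 * d - 1 - Real.log (a / 2) := by
  have h := Real.log_le_sub_one_of_pos (mul_pos (half_pos ha) hd)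
  rw [Real.log_mul (half_pos ha).ne' hd.ne'] at h
  linarith

/-- Theorem 1, upper bound: if `S` is positive semidefinite with strictly
positive diagonal, then for every `M` there is a constant `b > 0` (depending only on `M`, `λ`
and `S`) such that any symmetric `Ω` with nonzero diagonal entries and `Q(Ω) ≤ M` has
`|ω_kk| ≤ b` for all `k`. -/
theorem concord_level_set_diagonal_upper_bound
    {p : ℕ} (hp : 0 < p) (S : Matrix (Fin p) (Fin p) ℝ) (hS : S.PosSemidef)
    (hSdiag : ∀ k, 0 < S k k) (lam : ℝ) (hlam : 0 < lam) (M : ℝ) :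
    ∃ b : ℝ, 0 < b ∧
      ∀ Ω : Matrix (Fin p) (Fin p) ℝ, Ω.IsSymm → (∀ i, Ω i i ≠ 0) →
        Qobj S lam Ω ≤ M → ∀ k, |Ω k k| ≤ b := by
  set C : ℝ := 1 + ∑ i, ∑ j, |S i j|
  have hC : ∀ i j, |S i j| ≤ C := fun i j => by
    have h₁ : |S i j| ≤ ∑ j, |S i j| :=
      Finset.single_le_sum (f := fun j => |S i j|) (fun _ _ => abs_nonneg _) (mem_univ j)
    have h₂ : ∑ j, |S i j| ≤ ∑ i, ∑ j, |S i j| :=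
      Finset.single_le_sum (f := fun i => ∑ j, |S i j|)
        (fun _ _ => Finset.sum_nonneg fun _ _ => abs_nonneg _) (mem_univ i)
    linarith
  have hCpos : 0 < C := by positivity
  set t : ℝ := lam / C
  have ht : 0 < t := div_pos hlam hCpos
  have htC : t * C = lam := div_mul_cancel₀ _ hCpos.ne'
  have ha : ∀ i, 0 < t * S i i := fun i => mul_pos ht (hSdiag i)
  set K : Fin p → ℝ := fun i => 1 + Real.log (t * S i i / 2) - t ^ 2 * S i i / 2 with hK
  set B : Fin p → ℝ := fun k => |(M - ∑ i, K i) / (t * S k k / 2)|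
  have hB : ∀ k, B k ≤ ∑ k, B k := fun k =>
    Finset.single_le_sum (f := B) (fun _ _ => abs_nonneg _) (mem_univ k)
  refine ⟨1 + ∑ k, B k, by positivity, fun Ω hΩ hne hQ k => ?_⟩
  have hlower : ∑ i, (t * S i i / 2 * |Ω i i| + K i) ≤ Qobj S lam Ω := by
    rw [Qobj, h1, h2, trace_mul_mul_of_isSymm hΩ, Finset.mul_sum, Finset.mul_sum,
      ← Finset.sum_neg_distrib, ← Finset.sum_add_distrib, ← Finset.sum_add_distrib]
    refine Finset.sum_le_sum fun i _ => ?_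
    have hlin := linear_le_quadratic_add_l1 hS ht.le i (hC i) (Ω i)
    have hlog := log_le_half_mul_add (ha i) (abs_pos.mpr (hne i))
    rw [htC] at hlin
    simp only [hK]
    linarith
  rw [Finset.sum_add_distrib] at hlower
  have hterm : t * S k k / 2 * |Ω k k| ≤ ∑ i, t * S i i / 2 * |Ω i i| :=
    Finset.single_le_sum (f := fun i => t * S i i / 2 * |Ω i i|)
      (fun i _ => mul_nonneg (half_pos (ha i)).le (abs_nonneg _)) (mem_univ k)
  have hk : |Ω k k| ≤ (M - ∑ i, K i) / (t * S k k / 2) := by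
    rw [le_div_iff₀ (half_pos (ha k))]
    linarith
  have hkB : |Ω k k| ≤ B k := hk.trans (le_abs_self _)
  linarith [hB k]
end

section
/- (Theorem 1, lower bound.) Let S be positive semidefinite, let M ∈ ℝ and b > 0. If Ω is a symmetric matrix with all diagonal entries nonzero such that Q(Ω) ≤ M and |ω_ii| ≤ b for all i = 1,…,p, then for every k = 1,…,p, |ω_kk| ≥ a where a = exp(−M − (p−1) log b) > 0. -/
open Finset Matrix

/-- Theorem 1, lower bound: if `S` is positive semidefinite, `Q(Ω) ≤ M` and
`|ω_ii| ≤ b` for all `i`, then every diagonal entry satisfies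
`|ω_kk| ≥ a = exp(−M − (p−1) log b) > 0`. -/
theorem concord_level_set_diagonal_lower_bound
    {p : ℕ} (hp : 0 < p) (S : Matrix (Fin p) (Fin p) ℝ) (hS : S.PosSemidef)
    (lam : ℝ) (hlam : 0 < lam) (M : ℝ) (b : ℝ) (hb : 0 < b)
    (Ω : Matrix (Fin p) (Fin p) ℝ) (hΩ : Ω.IsSymm) (hdiag : ∀ i, Ω i i ≠ 0)
    (hQle : Qobj S lam Ω ≤ M) (hub : ∀ i, |Ω i i| ≤ b) :
    ∀ k, Real.exp (-M - ((p : ℝ) - 1) * Real.log b) ≤ |Ω k k| := by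
  intro k
  have htr : 0 ≤ (Ω * S * Ω).trace := by
    have h := (hS.mul_mul_conjTranspose_same Ω).trace_nonneg
    rwa [conjTranspose_eq_transpose_of_trivial, hΩ.eq] at h
  have hh2 : 0 ≤ h2 lam Ω :=
    mul_nonneg hlam.le (sum_nonneg fun i _ => sum_nonneg fun j _ => abs_nonneg _)
  have hrest : ∑ i ∈ univ.erase k, Real.log |Ω i i| ≤ ((p : ℝ) - 1) * Real.log b := by
    refine (sum_le_card_nsmul _ _ (Real.log b) fun i _ =>
      Real.log_le_log (abs_pos.mpr (hdiag i)) (hub i)).trans_eq ?_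
    rw [card_erase_of_mem (mem_univ k), card_univ, Fintype.card_fin, nsmul_eq_mul,
      Nat.cast_pred hp]
  have hsum := add_sum_erase univ (fun i => Real.log |Ω i i|) (mem_univ k)
  rw [← Real.le_log_iff_exp_le (abs_pos.mpr (hdiag k))]
  unfold Qobj h1 at hQle
  linarith
end

section
/- (Lipschitz continuity of the gradient.) Let a > 0 and set L = a^{-2} + ‖S‖₂. Then for all symmetric p×p matrices Ω and Θ whose diagonal entries are all at least a, ‖∇h1(Ω) − ∇h1(Θ)‖_F ≤ L ‖Ω − Θ‖_F, where ∇h1(Ω) = −Ω_D^{-1} + (1/2)(SΩ + ΩS). -/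
open Finset Matrix

/-- The spectral norm of a positive semidefinite real symmetric matrix:
its largest eigenvalue. -/
noncomputable def specNorm {p : ℕ} (S : Matrix (Fin p) (Fin p) ℝ)
    (hS : S.IsHermitian) : ℝ :=
  ⨆ i, hS.eigenvalues i

/-- The gradient of the smooth part of the CONCORD objective:
`∇h1(Ω) = −Ω_D⁻¹ + (1/2)(SΩ + ΩS)`. -/
noncomputable def gradH1 {p : ℕ} (S Ω : Matrix (Fin p) (Fin p) ℝ) :
    Matrix (Fin p) (Fin p) ℝ :=
  -(Matrix.diagonal fun i => Ω i i)⁻¹ + (1 / 2 : ℝ) • (S * Ω + Ω * S)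

section Frobenius

open scoped Matrix.Norms.Frobenius

theorem frobenius_norm_eq_sqrt {m n : Type*} [Fintype m] [Fintype n] (A : Matrix m n ℝ) :
    ‖A‖ = Real.sqrt (∑ i, ∑ j, (A i j) ^ 2) := by
  simp [Matrix.frobenius_norm_def, Real.sqrt_eq_rpow]

theorem eigenvalues_le_specNorm {p : ℕ} {S : Matrix (Fin p) (Fin p) ℝ}
    (hS : S.IsHermitian) (i : Fin p) : hS.eigenvalues i ≤ specNorm S hS :=
  le_ciSup (Set.finite_range _).bddAbove i

theorem specNorm_nonneg {p : ℕ} {S : Matrix (Fin p) (Fin p) ℝ} (hS : S.PosSemidef) :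
    0 ≤ specNorm S hS.1 :=
  Real.iSup_nonneg hS.eigenvalues_nonneg

theorem sum_sq_mulVec_le {p : ℕ} {S : Matrix (Fin p) (Fin p) ℝ} (hS : S.PosSemidef)
    (x : Fin p → ℝ) : ∑ i, (S *ᵥ x) i ^ 2 ≤ specNorm S hS.1 ^ 2 * ∑ i, x i ^ 2 := by
  set b := hS.1.eigenvectorBasis with hb
  have parseval (y : Fin p → ℝ) : ∑ i, y i ^ 2 = ∑ i, ((b i).ofLp ⬝ᵥ y) ^ 2 := by
    have h := b.sum_sq_norm_inner_right (WithLp.toLp 2 y)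
    rw [EuclideanSpace.norm_sq_eq] at h
    simpa [EuclideanSpace.inner_eq_star_dotProduct, dotProduct_comm] using h.symm
  have eigen (i : Fin p) :
      (b i).ofLp ⬝ᵥ (S *ᵥ x) = hS.1.eigenvalues i * ((b i).ofLp ⬝ᵥ x) := by
    have hT : Sᵀ = S := by simpa using hS.1.eq
    rw [dotProduct_mulVec, ← mulVec_transpose, hT, hb, hS.1.mulVec_eigenvectorBasis,
      smul_dotProduct, smul_eq_mul]
  rw [parseval, parseval x, mul_sum]
  refine sum_le_sum fun i _ => ?_
  rw [eigen, mul_pow]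
  have := hS.eigenvalues_nonneg i
  gcongr
  exact eigenvalues_le_specNorm hS.1 i

theorem frobenius_norm_mul_le_specNorm {p : ℕ} {S : Matrix (Fin p) (Fin p) ℝ}
    (hS : S.PosSemidef) (M : Matrix (Fin p) (Fin p) ℝ) :
    ‖S * M‖ ≤ specNorm S hS.1 * ‖M‖ := by
  have hs := specNorm_nonneg hS
  rw [frobenius_norm_eq_sqrt, frobenius_norm_eq_sqrt,
    Real.sqrt_le_left (by positivity), mul_pow, Real.sq_sqrt (by positivity),
    sum_comm, sum_comm (f := fun i j => M i j ^ 2), mul_sum]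
  exact sum_le_sum fun j _ => sum_sq_mulVec_le hS fun i => M i j

theorem frobenius_norm_mul_le_specNorm_right {p : ℕ} {S : Matrix (Fin p) (Fin p) ℝ}
    (hS : S.PosSemidef) (M : Matrix (Fin p) (Fin p) ℝ) :
    ‖M * S‖ ≤ specNorm S hS.1 * ‖M‖ := by
  have hT : Sᵀ = S := by simpa using hS.1.eq
  rw [← Matrix.frobenius_norm_transpose (M * S), ← Matrix.frobenius_norm_transpose M,
    transpose_mul, hT]
  exact frobenius_norm_mul_le_specNorm hS Mᵀ

theorem inv_diagonal_of_le {p : ℕ} {a : ℝ} (ha : 0 < a) {d : Fin p → ℝ} (hd : ∀ i, a ≤ d i) :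
    (diagonal d)⁻¹ = diagonal fun i => (d i)⁻¹ := by
  refine inv_eq_right_inv ?_
  rw [diagonal_mul_diagonal, ← diagonal_one]
  congr 1
  ext i
  exact mul_inv_cancel₀ (ha.trans_le (hd i)).ne'

theorem sq_inv_sub_inv_le {a x y : ℝ} (ha : 0 < a) (hx : a ≤ x) (hy : a ≤ y) :
    (y⁻¹ - x⁻¹) ^ 2 ≤ (a ^ 2)⁻¹ ^ 2 * (x - y) ^ 2 := by
  have hx0 := ha.trans_le hx
  have hy0 := ha.trans_le hy
  have h : y⁻¹ - x⁻¹ = (x * y)⁻¹ * (x - y) := by field_simp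
  rw [h, mul_pow]
  gcongr
  nlinarith

theorem frobenius_norm_inv_diagonal_sub_le {p : ℕ} {a : ℝ} (ha : 0 < a)
    {Ω Θ : Matrix (Fin p) (Fin p) ℝ} (hΩ : ∀ i, a ≤ Ω i i) (hΘ : ∀ i, a ≤ Θ i i) :
    ‖(diagonal fun i => Θ i i)⁻¹ - (diagonal fun i => Ω i i)⁻¹‖ ≤ (a ^ 2)⁻¹ * ‖Ω - Θ‖ := by
  rw [inv_diagonal_of_le ha hΩ, inv_diagonal_of_le ha hΘ, frobenius_norm_eq_sqrt,
    frobenius_norm_eq_sqrt, Real.sqrt_le_left (by positivity), mul_pow,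
    Real.sq_sqrt (by positivity), mul_sum]
  refine sum_le_sum fun i _ => ?_
  rw [mul_sum]
  refine sum_le_sum fun j _ => ?_
  rcases eq_or_ne i j with rfl | hij
  · simpa using sq_inv_sub_inv_le ha (hΩ i) (hΘ i)
  · rw [Matrix.sub_apply, diagonal_apply_ne _ hij, diagonal_apply_ne _ hij, sub_zero,
      zero_pow two_ne_zero]
    positivity

theorem frobenius_norm_gradH1_sub_le {p : ℕ} {S : Matrix (Fin p) (Fin p) ℝ}
    (hS : S.PosSemidef) {a : ℝ} (ha : 0 < a)
    {Ω Θ : Matrix (Fin p) (Fin p) ℝ} (hΩ : ∀ i, a ≤ Ω i i) (hΘ : ∀ i, a ≤ Θ i i) :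
    ‖gradH1 S Ω - gradH1 S Θ‖ ≤ ((a ^ 2)⁻¹ + specNorm S hS.1) * ‖Ω - Θ‖ := by
  have h : gradH1 S Ω - gradH1 S Θ =
      ((diagonal fun i => Θ i i)⁻¹ - (diagonal fun i => Ω i i)⁻¹) +
        (1 / 2 : ℝ) • (S * (Ω - Θ) + (Ω - Θ) * S) := by
    simp only [gradH1, mul_sub, sub_mul, smul_add, smul_sub]
    abel
  have h₁ := frobenius_norm_inv_diagonal_sub_le ha hΩ hΘ
  have h₂ := frobenius_norm_mul_le_specNorm hS (Ω - Θ)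
  have h₃ := frobenius_norm_mul_le_specNorm_right hS (Ω - Θ)
  have h₄ := norm_add_le (S * (Ω - Θ)) ((Ω - Θ) * S)
  rw [h]
  refine (norm_add_le _ _).trans ?_
  rw [norm_smul, Real.norm_of_nonneg (by norm_num)]
  linarith

end Frobenius

/-- Lipschitz continuity of the gradient: with `L = a⁻² + ‖S‖₂`, for all
symmetric `Ω`, `Θ` whose diagonal entries are all at least `a > 0`,
`‖∇h1(Ω) − ∇h1(Θ)‖_F ≤ L ‖Ω − Θ‖_F`. -/
theorem concord_gradient_lipschitz
    {p : ℕ} (hp : 0 < p) (S : Matrix (Fin p) (Fin p) ℝ) (hS : S.PosSemidef)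
    (lam : ℝ) (hlam : 0 < lam) (a : ℝ) (ha : 0 < a)
    (L : ℝ) (hL : L = (a ^ 2)⁻¹ + specNorm S hS.1)
    (Ω Θ : Matrix (Fin p) (Fin p) ℝ) (hΩ : Ω.IsSymm) (hΘ : Θ.IsSymm)
    (hΩdiag : ∀ i, a ≤ Ω i i) (hΘdiag : ∀ i, a ≤ Θ i i) :
    Real.sqrt (∑ i, ∑ j, ((gradH1 S Ω - gradH1 S Θ) i j) ^ 2)
      ≤ L * Real.sqrt (∑ i, ∑ j, ((Ω - Θ) i j) ^ 2) := by
  subst hL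
  simpa only [frobenius_norm_eq_sqrt] using frobenius_norm_gradH1_sub_le hS ha hΩdiag hΘdiag
end

section
/- (Convexity of the CONCORD objective.) If S is positive semidefinite, then the CONCORD objective Q(Ω) = −Σ_{i=1}^p log ω_ii + (1/2) tr(ΩSΩ) + λ Σ_{i≠j} |ω_ij| is a convex function on the convex set of symmetric p×p matrices with strictly positive diagonal entries. -/
open Finset Matrix

/-- Defect of convexity of the quadratic map `X ↦ X * S * X`. -/
theorem Matrix.smul_mul_mul_add_sub_eq {n : Type*} [Fintype n] (S X Y : Matrix n n ℝ)
    {a b : ℝ} (hab : a + b = 1) :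
    a • (X * S * X) + b • (Y * S * Y) - (a • X + b • Y) * S * (a • X + b • Y)
      = (a * b) • ((X - Y) * S * (X - Y)) := by
  obtain rfl : b = 1 - a := by linarith
  simp only [add_mul, mul_add, sub_mul, mul_sub, smul_mul_assoc, mul_smul_comm]
  module

theorem Matrix.PosSemidef.trace_mul_mul_self_nonneg {n : Type*} [Fintype n]
    {S Z : Matrix n n ℝ} (hS : S.PosSemidef) (hZ : Z.IsSymm) : 0 ≤ (Z * S * Z).trace := by
  have h := (hS.conjTranspose_mul_mul_same Z).trace_nonneg
  rwa [conjTranspose_eq_transpose_of_trivial, hZ.eq] at h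

theorem convex_isSymm_diag_pos (n : Type*) :
    Convex ℝ {Ω : Matrix n n ℝ | Ω.IsSymm ∧ ∀ i, 0 < Ω i i} := by
  rintro X ⟨hX, hX'⟩ Y ⟨hY, hY'⟩ a b ha hb hab
  exact ⟨(hX.smul a).add (hY.smul b), fun i =>
    convex_Ioi (0 : ℝ) (hX' i) (hY' i) ha hb hab⟩

theorem convexOn_neg_sum_log_diag (n : Type*) [Fintype n] :
    ConvexOn ℝ {Ω : Matrix n n ℝ | Ω.IsSymm ∧ ∀ i, 0 < Ω i i}
      (fun Ω => -(∑ i, Real.log (Ω i i))) := by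
  refine ⟨convex_isSymm_diag_pos n, ?_⟩
  rintro X ⟨_, hX⟩ Y ⟨_, hY⟩ a b ha hb hab
  have h : ∑ i, (a * Real.log (X i i) + b * Real.log (Y i i))
      ≤ ∑ i, Real.log ((a • X + b • Y) i i) :=
    sum_le_sum fun i _ =>
      strictConcaveOn_log_Ioi.concaveOn.2 (hX i) (hY i) ha hb hab
  rw [sum_add_distrib, ← mul_sum, ← mul_sum] at h
  simp only [smul_eq_mul]
  linarith

theorem Matrix.PosSemidef.convexOn_trace_mul_mul_self {n : Type*} [Fintype n]
    {S : Matrix n n ℝ} (hS : S.PosSemidef) :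
    ConvexOn ℝ {Ω : Matrix n n ℝ | Ω.IsSymm ∧ ∀ i, 0 < Ω i i}
      (fun Ω => (Ω * S * Ω).trace) := by
  refine ⟨convex_isSymm_diag_pos n, ?_⟩
  rintro X ⟨hX, _⟩ Y ⟨hY, _⟩ a b ha hb hab
  have h := congrArg trace (smul_mul_mul_add_sub_eq S X Y hab)
  simp only [trace_sub, trace_add (a • (X * S * X)), trace_smul] at h
  have h' := mul_nonneg (mul_nonneg ha hb) (hS.trace_mul_mul_self_nonneg (hX.sub hY))
  simp only [smul_eq_mul] at h ⊢
  linarith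

theorem convexOn_sum_abs_offDiag {n : Type*} [Fintype n] [DecidableEq n]
    {s : Set (Matrix n n ℝ)} (hs : Convex ℝ s) :
    ConvexOn ℝ s (fun Ω => ∑ i, ∑ j ∈ univ.filter (fun j => j ≠ i), |Ω i j|) := by
  refine ⟨hs, ?_⟩
  intro X _ Y _ a b ha hb _
  simp only [smul_eq_mul, mul_sum, ← sum_add_distrib]
  refine sum_le_sum fun i _ => sum_le_sum fun j _ => ?_
  calc |a * X i j + b * Y i j| ≤ |a * X i j| + |b * Y i j| := abs_add_le _ _
    _ = a * |X i j| + b * |Y i j| := by rw [abs_mul, abs_mul, abs_of_nonneg ha, abs_of_nonneg hb]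

/-- convexity of the CONCORD objective: if `S` is positive semidefinite, the
set of symmetric matrices with strictly positive diagonal entries is convex and the CONCORD
objective `Q(Ω) = −Σ_i log ω_ii + (1/2) tr(ΩSΩ) + λ Σ_{i≠j} |ω_ij|` is convex on it. -/
theorem concord_objective_convex
    {p : ℕ} (hp : 0 < p) (S : Matrix (Fin p) (Fin p) ℝ) (hS : S.PosSemidef)
    (lam : ℝ) (hlam : 0 < lam) :
    Convex ℝ {Ω : Matrix (Fin p) (Fin p) ℝ | Ω.IsSymm ∧ ∀ i, 0 < Ω i i} ∧
    ConvexOn ℝ {Ω : Matrix (Fin p) (Fin p) ℝ | Ω.IsSymm ∧ ∀ i, 0 < Ω i i}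
      (fun Ω => -(∑ i, Real.log (Ω i i)) + (1 / 2) * (Ω * S * Ω).trace
        + lam * ∑ i, ∑ j ∈ Finset.univ.filter (fun j => j ≠ i), |Ω i j|) := by
  have hconv := convex_isSymm_diag_pos (Fin p)
  exact ⟨hconv, ((convexOn_neg_sum_log_diag (Fin p)).add
    (hS.convexOn_trace_mul_mul_self.smul (by norm_num))).add
    ((convexOn_sum_abs_offDiag hconv).smul hlam.le)⟩
end

section
/- (Sufficient decrease of a proximal gradient step.) Let C be a convex set of symmetric p×p matrices with strictly positive diagonal entries on which h1 is convex and differentiable, let τ > 0, let Ω ∈ C, and let Ω' be the unique minimizer over symmetric Θ of h2(Θ) + (1/(2τ))‖Θ − (Ω − τ∇h1(Ω))‖_F². If Ω' ∈ C and the sufficient descent condition h1(Ω') ≤ h1(Ω) + tr((Ω' − Ω)ᵀ∇h1(Ω)) + (1/(2τ))‖Ω' − Ω‖_F² holds, then Q(Ω') ≤ Q(Ω) − (1/(2τ))‖Ω' − Ω‖_F²; in particular the iterates of CONCORD-ISTA produce non-increasing objective values. -/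
open Finset Matrix

attribute [local instance] Matrix.normedAddCommGroup Matrix.normedSpace

/-- The squared Frobenius norm `‖A‖_F² = Σ_{i,j} a_ij²`. -/
def frobSq {p : ℕ} (A : Matrix (Fin p) (Fin p) ℝ) : ℝ :=
  ∑ i, ∑ j, (A i j) ^ 2

theorem trace_transpose_mul_eq_sum {p : ℕ} (A B : Matrix (Fin p) (Fin p) ℝ) :
    (Aᵀ * B).trace = ∑ i, ∑ j, A i j * B i j := by
  simp only [Matrix.trace, Matrix.diag, Matrix.mul_apply, Matrix.transpose_apply]
  exact Finset.sum_comm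

theorem frobSq_eq_trace {p : ℕ} (A : Matrix (Fin p) (Fin p) ℝ) :
    frobSq A = (Aᵀ * A).trace := by
  simp only [trace_transpose_mul_eq_sum, frobSq, sq]

theorem frobSq_nonneg {p : ℕ} (A : Matrix (Fin p) (Fin p) ℝ) : 0 ≤ frobSq A :=
  Finset.sum_nonneg fun _ _ => Finset.sum_nonneg fun _ _ => sq_nonneg _

theorem frobSq_sub_smul {p : ℕ} (A D : Matrix (Fin p) (Fin p) ℝ) (t : ℝ) :
    frobSq (A - t • D) = frobSq A - 2 * t * (Dᵀ * A).trace + t ^ 2 * frobSq D := by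
  simp only [trace_transpose_mul_eq_sum, frobSq, Finset.mul_sum, ← Finset.sum_sub_distrib,
    ← Finset.sum_add_distrib, Matrix.sub_apply, Matrix.smul_apply, smul_eq_mul]
  refine Finset.sum_congr rfl fun i _ => Finset.sum_congr rfl fun j _ => ?_
  ring

theorem convexOn_h2 {p : ℕ} {lam : ℝ} (hlam : 0 ≤ lam) :
    ConvexOn ℝ Set.univ (h2 (p := p) lam) := by
  refine ⟨convex_univ, fun A _ B _ a b ha hb _ => ?_⟩
  have key : ∀ i j, |(a • A + b • B) i j| ≤ a * |A i j| + b * |B i j| := fun i j => by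
    simpa [abs_mul, abs_of_nonneg ha, abs_of_nonneg hb] using abs_add_le (a * A i j) (b * B i j)
  calc h2 lam (a • A + b • B)
      ≤ lam * ∑ i, ∑ j ∈ Finset.univ.filter (fun j => j ≠ i), (a * |A i j| + b * |B i j|) :=
        mul_le_mul_of_nonneg_left
          (Finset.sum_le_sum fun i _ => Finset.sum_le_sum fun j _ => key i j) hlam
    _ = a • h2 lam A + b • h2 lam B := by
        simp only [h2, Finset.sum_add_distrib, ← Finset.mul_sum, smul_eq_mul]
        ring

theorem nonpos_of_forall_le_mul {a b : ℝ} (hb : 0 ≤ b)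
    (h : ∀ t : ℝ, 0 < t → t ≤ 1 → a ≤ t * b) : a ≤ 0 := by
  by_contra! ha
  have hab : 0 < a + b := by linarith
  have := h (a / (a + b)) (by positivity) ((div_le_one hab).2 (by linarith))
  rw [div_mul_eq_mul_div, le_div_iff₀ hab] at this
  nlinarith

/-- The variational inequality satisfied by a proximal step with step size `τ` and direction `G`. -/
theorem h2_prox_le {p : ℕ} {lam τ : ℝ} (hlam : 0 ≤ lam) (hτ : 0 < τ)
    {Ω Ω' G : Matrix (Fin p) (Fin p) ℝ} (hΩ : Ω.IsSymm) (hΩ' : Ω'.IsSymm)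
    (hmin : ∀ Θ : Matrix (Fin p) (Fin p) ℝ, Θ.IsSymm →
      h2 lam Ω' + (1 / (2 * τ)) * frobSq (Ω' - (Ω - τ • G))
        ≤ h2 lam Θ + (1 / (2 * τ)) * frobSq (Θ - (Ω - τ • G))) :
    h2 lam Ω' ≤ h2 lam Ω - ((Ω' - Ω)ᵀ * G).trace - (1 / τ) * frobSq (Ω' - Ω) := by
  have hinner : ((Ω' - Ω)ᵀ * (Ω' - (Ω - τ • G))).trace
      = frobSq (Ω' - Ω) + τ * ((Ω' - Ω)ᵀ * G).trace := by
    rw [frobSq_eq_trace, ← sub_add, Matrix.mul_add, Matrix.trace_add, Matrix.mul_smul,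
      Matrix.trace_smul, smul_eq_mul]
  suffices h2 lam Ω' - h2 lam Ω + ((Ω' - Ω)ᵀ * G).trace + (1 / τ) * frobSq (Ω' - Ω) ≤ 0 by
    linarith
  refine nonpos_of_forall_le_mul (b := (1 / (2 * τ)) * frobSq (Ω' - Ω))
    (mul_nonneg (by positivity) (frobSq_nonneg _)) fun t ht ht1 => ?_
  have hm := hmin ((1 - t) • Ω' + t • Ω) ((hΩ'.smul _).add (hΩ.smul _))
  have hc : h2 lam ((1 - t) • Ω' + t • Ω) ≤ (1 - t) * h2 lam Ω' + t * h2 lam Ω :=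
    (convexOn_h2 hlam).2 (Set.mem_univ _) (Set.mem_univ _) (by linarith) ht.le (by ring)
  have hΘ : (1 - t) • Ω' + t • Ω - (Ω - τ • G) = Ω' - (Ω - τ • G) - t • (Ω' - Ω) := by
    module
  rw [hΘ, frobSq_sub_smul, hinner] at hm
  refine le_of_mul_le_mul_left ?_ ht
  have hexp : ∀ x y z : ℝ, (1 / (2 * τ)) * (x - 2 * t * (y + τ * z) + t ^ 2 * y)
      = (1 / (2 * τ)) * x - t * ((1 / τ) * y) - t * z + t * (t * ((1 / (2 * τ)) * y)) := by
    intro x y z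
    field_simp
    ring
  rw [hexp] at hm
  linarith

/-- sufficient decrease of a proximal gradient step: if `Ω'` is the unique
minimizer over symmetric `Θ` of `h2(Θ) + (1/(2τ))‖Θ − (Ω − τ∇h1(Ω))‖_F²`, `Ω' ∈ C`, and
the sufficient descent condition holds, then
`Q(Ω') ≤ Q(Ω) − (1/(2τ))‖Ω' − Ω‖_F²`. -/
theorem concord_prox_step_sufficient_decrease
    {p : ℕ} (hp : 0 < p) (S : Matrix (Fin p) (Fin p) ℝ) (hS : S.PosSemidef)
    (lam : ℝ) (hlam : 0 < lam)
    (C : Set (Matrix (Fin p) (Fin p) ℝ)) (hC : Convex ℝ C)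
    (hCsym : ∀ A ∈ C, Matrix.IsSymm A) (hCdiag : ∀ A ∈ C, ∀ i, 0 < A i i)
    (hconv : ConvexOn ℝ C (h1 S)) (hdiff : DifferentiableOn ℝ (h1 S) C)
    (τ : ℝ) (hτ : 0 < τ)
    (Ω : Matrix (Fin p) (Fin p) ℝ) (hΩC : Ω ∈ C)
    (Ω' : Matrix (Fin p) (Fin p) ℝ) (hΩ'symm : Ω'.IsSymm)
    (hmin : ∀ Θ : Matrix (Fin p) (Fin p) ℝ, Θ.IsSymm →
      h2 lam Ω' + (1 / (2 * τ)) * frobSq (Ω' - (Ω - τ • gradH1 S Ω))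
        ≤ h2 lam Θ + (1 / (2 * τ)) * frobSq (Θ - (Ω - τ • gradH1 S Ω)))
    (huniq : ∀ Θ : Matrix (Fin p) (Fin p) ℝ, Θ.IsSymm →
      h2 lam Θ + (1 / (2 * τ)) * frobSq (Θ - (Ω - τ • gradH1 S Ω))
          ≤ h2 lam Ω' + (1 / (2 * τ)) * frobSq (Ω' - (Ω - τ • gradH1 S Ω)) →
        Θ = Ω')
    (hΩ'C : Ω' ∈ C)
    (hdesc : h1 S Ω' ≤ h1 S Ω + ((Ω' - Ω)ᵀ * gradH1 S Ω).trace
        + (1 / (2 * τ)) * frobSq (Ω' - Ω)) :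
    Qobj S lam Ω' ≤ Qobj S lam Ω - (1 / (2 * τ)) * frobSq (Ω' - Ω) := by
  have hprox := h2_prox_le hlam.le hτ (hCsym Ω hΩC) hΩ'symm hmin
  have hhalf : (1 / τ) * frobSq (Ω' - Ω) = 2 * ((1 / (2 * τ)) * frobSq (Ω' - Ω)) := by
    field_simp
  unfold Qobj
  linarith
end

section
/- (Dual gradient and Hessian bound on a level set.) For y in the domain D = { y ∈ ℝ^N : (A1ᵀy)_i > 0 for all i }, the gradient of h is ∇h(y) = y − A1 v(y), where v(y) ∈ ℝ^p has entries v(y)_i = n/(A1ᵀy)_i, and the Hessian is ∇²h(y) = I + A1 diag( n/(A1ᵀy)_i² ) A1ᵀ. Moreover, if (A1ᵀy)_i ≥ e^{−M/n} for all i (for some M ∈ ℝ), then ∇²h(y) ⪯ (1 + n ρ(A1ᵀA1) e^{2M/n}) I, where ρ(A1ᵀA1) is the largest eigenvalue of A1ᵀA1. -/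
open Finset Matrix

/-- The smooth part of the dual of the CONCORD problem:
`h(y) = (1/2)‖y‖₂² − n Σ_i log((A1ᵀy)_i)`. -/
noncomputable def dualH {N p : ℕ} (A1 : Matrix (Fin N) (Fin p) ℝ) (n : ℝ)
    (y : Fin N → ℝ) : ℝ :=
  (1 / 2) * ∑ k, (y k) ^ 2 - n * ∑ i, Real.log (A1ᵀ.mulVec y i)

/-- The gradient of the dual smooth function: `∇h(y) = y − A1·(n ./ (A1ᵀy))`. -/
noncomputable def dualGrad {N p : ℕ} (A1 : Matrix (Fin N) (Fin p) ℝ) (n : ℝ)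
    (y : Fin N → ℝ) : Fin N → ℝ :=
  y - A1.mulVec fun i => n / A1ᵀ.mulVec y i

/-- The Hessian of the dual smooth function:
`∇²h(y) = I + A1 · diag(n / (A1ᵀy)_i²) · A1ᵀ`. -/
noncomputable def dualHess {N p : ℕ} (A1 : Matrix (Fin N) (Fin p) ℝ) (n : ℝ)
    (y : Fin N → ℝ) : Matrix (Fin N) (Fin N) ℝ :=
  1 + A1 * Matrix.diagonal (fun i => n / (A1ᵀ.mulVec y i) ^ 2) * A1ᵀ

theorem dualGrad_dotProduct {N p : ℕ} (A1 : Matrix (Fin N) (Fin p) ℝ) (n : ℝ)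
    (y v : Fin N → ℝ) :
    dualGrad A1 n y ⬝ᵥ v = y ⬝ᵥ v - n * ∑ i, A1ᵀ.mulVec v i / A1ᵀ.mulVec y i := by
  rw [dualGrad, sub_dotProduct, dotProduct_comm (A1.mulVec _), dotProduct_mulVec,
    ← mulVec_transpose, Finset.mul_sum]
  congr 1
  exact Finset.sum_congr rfl fun i _ => by ring

theorem dotProduct_dualHess_mulVec {N p : ℕ} (A1 : Matrix (Fin N) (Fin p) ℝ) (n : ℝ)
    (y v : Fin N → ℝ) :
    v ⬝ᵥ (dualHess A1 n y).mulVec v =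
      v ⬝ᵥ v + n * ∑ i, (A1ᵀ.mulVec v i) ^ 2 / (A1ᵀ.mulVec y i) ^ 2 := by
  rw [dualHess, add_mulVec, one_mulVec, dotProduct_add, ← mulVec_mulVec, ← mulVec_mulVec,
    dotProduct_mulVec v A1, ← mulVec_transpose, Finset.mul_sum]
  congr 1
  refine Finset.sum_congr rfl fun i _ => ?_
  rw [mulVec_diagonal]
  ring

theorem hasDerivAt_mulVec_line {N p : ℕ} (B : Matrix (Fin p) (Fin N) ℝ) (y v : Fin N → ℝ)
    (i : Fin p) (t : ℝ) :
    HasDerivAt (fun s : ℝ => B.mulVec (y + s • v) i) (B.mulVec v i) t := by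
  simp only [mulVec_add, mulVec_smul, Pi.add_apply, Pi.smul_apply, smul_eq_mul]
  simpa using ((hasDerivAt_id t).mul_const (B.mulVec v i)).const_add (B.mulVec y i)

theorem hasDerivAt_coord_line {N : ℕ} (y v : Fin N → ℝ) (k : Fin N) (t : ℝ) :
    HasDerivAt (fun s : ℝ => (y + s • v) k) (v k) t := by
  simpa using hasDerivAt_mulVec_line 1 y v k t

/-- Along a line through the domain, `dualH` has derivative `⟨dualGrad, v⟩`. -/
theorem hasDerivAt_dualH_line {N p : ℕ} (A1 : Matrix (Fin N) (Fin p) ℝ) (n : ℝ)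
    (y v : Fin N → ℝ) (t : ℝ) (ht : ∀ i, 0 < A1ᵀ.mulVec (y + t • v) i) :
    HasDerivAt (fun s : ℝ => dualH A1 n (y + s • v)) (dualGrad A1 n (y + t • v) ⬝ᵥ v) t := by
  have hq := (HasDerivAt.fun_sum (u := Finset.univ) fun k _ =>
    (hasDerivAt_coord_line y v k t).fun_pow 2).const_mul (1 / 2 : ℝ)
  have hl := (HasDerivAt.fun_sum (u := Finset.univ) fun i _ =>
    (hasDerivAt_mulVec_line A1ᵀ y v i t).log (ht i).ne').const_mul n
  refine (hq.sub hl).congr_deriv ?_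
  rw [dualGrad_dotProduct, dotProduct, Finset.mul_sum]
  congr 1
  exact Finset.sum_congr rfl fun k _ => by push_cast; ring

/-- Along a line through the domain, the second derivative of `dualH` is the quadratic form of
`dualHess`. -/
theorem hasDerivAt_dualGrad_line {N p : ℕ} (A1 : Matrix (Fin N) (Fin p) ℝ) (n : ℝ)
    (y v : Fin N → ℝ) (hy : ∀ i, 0 < A1ᵀ.mulVec y i) :
    HasDerivAt (fun s : ℝ => dualGrad A1 n (y + s • v) ⬝ᵥ v)
      (v ⬝ᵥ (dualHess A1 n y).mulVec v) 0 := by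
  have hq := HasDerivAt.fun_sum (u := Finset.univ) fun k _ =>
    (hasDerivAt_coord_line y v k 0).mul_const (v k)
  have hl := (HasDerivAt.fun_sum (u := Finset.univ) fun i _ =>
    (hasDerivAt_const (0 : ℝ) (A1ᵀ.mulVec v i)).fun_div (hasDerivAt_mulVec_line A1ᵀ y v i 0)
      (by simpa using (hy i).ne')).const_mul n
  simp only [dualGrad_dotProduct]
  refine (hq.sub hl).congr_deriv ?_
  rw [dotProduct_dualHess_mulVec, sub_eq_add_neg, ← mul_neg, ← Finset.sum_neg_distrib]
  congr 2
  refine Finset.sum_congr rfl fun i _ => ?_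
  simp only [zero_smul, add_zero]
  ring

theorem eventually_line_mem_domain {N p : ℕ} (A1 : Matrix (Fin N) (Fin p) ℝ)
    (y v : Fin N → ℝ) (hy : ∀ i, 0 < A1ᵀ.mulVec y i) :
    ∀ᶠ t in nhds (0 : ℝ), ∀ i, 0 < A1ᵀ.mulVec (y + t • v) i :=
  Filter.eventually_all.2 fun i =>
    (hasDerivAt_mulVec_line A1ᵀ y v i 0).continuousAt.eventually_const_lt (by simpa using hy i)

theorem posSemidef_specNorm_smul_one_sub {p : ℕ} (S : Matrix (Fin p) (Fin p) ℝ)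
    (hS : S.IsHermitian) :
    (specNorm S hS • (1 : Matrix (Fin p) (Fin p) ℝ) - S).PosSemidef := by
  set U : Matrix (Fin p) (Fin p) ℝ := ↑hS.eigenvectorUnitary
  have hUU : U * star U = 1 := Unitary.coe_mul_star_self hS.eigenvectorUnitary
  have hspec : S = U * diagonal hS.eigenvalues * star U := by
    have h := hS.spectral_theorem
    rwa [Unitary.conjStarAlgAut_apply] at h
  have hdiag : (diagonal fun i => specNorm S hS - hS.eigenvalues i).PosSemidef :=
    posSemidef_diagonal_iff.2 fun i =>
      sub_nonneg.2 (le_ciSup (Set.finite_range hS.eigenvalues).bddAbove i)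
  have heq : specNorm S hS • (1 : Matrix (Fin p) (Fin p) ℝ) - S =
      U * (diagonal fun i => specNorm S hS - hS.eigenvalues i) * star U := by
    rw [← diagonal_sub, ← smul_one_eq_diagonal, mul_sub, sub_mul, ← hspec, mul_smul_comm, mul_one,
      smul_mul_assoc, hUU]
  rw [heq]
  exact hdiag.mul_mul_conjTranspose_same U

theorem specNorm_transpose_mul_self_nonneg {N p : ℕ} (A : Matrix (Fin N) (Fin p) ℝ)
    (hH : (Aᵀ * A).IsHermitian) : 0 ≤ specNorm (Aᵀ * A) hH := by
  refine Real.iSup_nonneg fun i => ?_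
  have hpsd : (Aᵀ * A).PosSemidef := by
    simpa using posSemidef_conjTranspose_mul_self A
  exact hpsd.eigenvalues_nonneg i

theorem transpose_mulVec_dotProduct_self_le {N p : ℕ} (A : Matrix (Fin N) (Fin p) ℝ)
    (hH : (Aᵀ * A).IsHermitian) (x : Fin N → ℝ) :
    Aᵀ.mulVec x ⬝ᵥ Aᵀ.mulVec x ≤ specNorm (Aᵀ * A) hH * (x ⬝ᵥ x) := by
  set ρ := specNorm (Aᵀ * A) hH
  obtain ⟨w, hw⟩ : ∃ w, Aᵀ.mulVec x = w := ⟨_, rfl⟩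
  rw [hw]
  have hx0 : 0 ≤ x ⬝ᵥ x := dotProduct_self_star_nonneg x
  have hAw : A.mulVec w ⬝ᵥ A.mulVec w ≤ ρ * (w ⬝ᵥ w) := by
    have h := (posSemidef_specNorm_smul_one_sub _ hH).dotProduct_mulVec_nonneg w
    rw [star_trivial, sub_mulVec, dotProduct_sub, smul_mulVec, one_mulVec, dotProduct_smul,
      smul_eq_mul, ← mulVec_mulVec, dotProduct_mulVec, vecMul_transpose] at h
    exact sub_nonneg.1 h
  have hcs : (w ⬝ᵥ w) ^ 2 ≤ (x ⬝ᵥ x) * (A.mulVec w ⬝ᵥ A.mulVec w) := by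
    have hxw : w ⬝ᵥ w = x ⬝ᵥ A.mulVec w := by
      rw [dotProduct_mulVec, ← mulVec_transpose, hw]
    rw [hxw]
    simpa only [dotProduct, sq] using Finset.sum_mul_sq_le_sq_mul_sq Finset.univ x (A.mulVec w)
  rcases (show 0 ≤ w ⬝ᵥ w from dotProduct_self_star_nonneg w).eq_or_lt with h0 | h0
  · rw [← h0]
    exact mul_nonneg (specNorm_transpose_mul_self_nonneg A hH) hx0
  · refine le_of_mul_le_mul_right ?_ h0
    calc (w ⬝ᵥ w) * (w ⬝ᵥ w) = (w ⬝ᵥ w) ^ 2 := (sq _).symm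
      _ ≤ (x ⬝ᵥ x) * (ρ * (w ⬝ᵥ w)) := hcs.trans (mul_le_mul_of_nonneg_left hAw hx0)
      _ = ρ * (x ⬝ᵥ x) * (w ⬝ᵥ w) := by ring

theorem isHermitian_dualHess {N p : ℕ} (A1 : Matrix (Fin N) (Fin p) ℝ) (n : ℝ)
    (y : Fin N → ℝ) : (dualHess A1 n y).IsHermitian := by
  simp [dualHess, IsHermitian, conjTranspose_eq_transpose_of_trivial, Matrix.mul_assoc]

theorem inv_sq_le_exp {a M n : ℝ} (ha : Real.exp (-(M / n)) ≤ a) :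
    1 / a ^ 2 ≤ Real.exp (2 * M / n) := by
  have hexp : Real.exp (2 * M / n) = 1 / Real.exp (-(M / n)) ^ 2 := by
    rw [one_div, ← Real.exp_nat_mul, ← Real.exp_neg]
    congr 1
    push_cast
    ring
  rw [hexp]
  gcongr

/-- dual gradient and Hessian bound on a level set: on
`D = {y : (A1ᵀy)_i > 0 ∀i}`, the gradient of `h` is `∇h(y) = y − A1·(n./(A1ᵀy))`, the
second directional derivative is given by the Hessian
`∇²h(y) = I + A1·diag(n/(A1ᵀy)_i²)·A1ᵀ`, and if `(A1ᵀy)_i ≥ e^{−M/n}` for all `i`, then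
`∇²h(y) ⪯ (1 + n ρ(A1ᵀA1) e^{2M/n}) I`. -/
theorem concord_dual_gradient_hessian_bound
    {N p : ℕ} (hp : 0 < p) (A1 : Matrix (Fin N) (Fin p) ℝ) (n : ℝ) (hn : 0 < n)
    (M : ℝ) (hH : (A1ᵀ * A1).IsHermitian) :
    (∀ y : Fin N → ℝ, (∀ i, 0 < A1ᵀ.mulVec y i) →
      ∀ v : Fin N → ℝ,
        HasDerivAt (fun t : ℝ => dualH A1 n (y + t • v))
          (∑ k, dualGrad A1 n y k * v k) 0) ∧
    (∀ y : Fin N → ℝ, (∀ i, 0 < A1ᵀ.mulVec y i) →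
      ∀ v : Fin N → ℝ,
        deriv (deriv (fun t : ℝ => dualH A1 n (y + t • v))) 0
          = v ⬝ᵥ (dualHess A1 n y).mulVec v) ∧
    (∀ y : Fin N → ℝ, (∀ i, Real.exp (-(M / n)) ≤ A1ᵀ.mulVec y i) →
      ((1 + n * specNorm (A1ᵀ * A1) hH * Real.exp (2 * M / n)) •
          (1 : Matrix (Fin N) (Fin N) ℝ) - dualHess A1 n y).PosSemidef) := by
  refine ⟨fun y hy v => ?_, fun y hy v => ?_, fun y hy => ?_⟩
  · simpa [dotProduct] using hasDerivAt_dualH_line A1 n y v 0 (by simpa using hy)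
  · have hev : deriv (fun t : ℝ => dualH A1 n (y + t • v)) =ᶠ[nhds 0]
        fun t => dualGrad A1 n (y + t • v) ⬝ᵥ v :=
      (eventually_line_mem_domain A1 y v hy).mono fun t ht =>
        (hasDerivAt_dualH_line A1 n y v t ht).deriv
    rw [hev.deriv_eq]
    exact (hasDerivAt_dualGrad_line A1 n y v hy).deriv
  · refine .of_dotProduct_mulVec_nonneg
      ((isHermitian_one.smul (IsSelfAdjoint.all _)).sub (isHermitian_dualHess A1 n y)) fun x => ?_
    have hsum : ∑ i, (A1ᵀ.mulVec x i) ^ 2 / (A1ᵀ.mulVec y i) ^ 2 ≤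
        Real.exp (2 * M / n) * (specNorm (A1ᵀ * A1) hH * (x ⬝ᵥ x)) := by
      refine le_trans ?_ (mul_le_mul_of_nonneg_left
        (transpose_mulVec_dotProduct_self_le A1 hH x) (Real.exp_nonneg _))
      rw [dotProduct, Finset.mul_sum]
      refine Finset.sum_le_sum fun i _ => ?_
      rw [← sq, div_eq_mul_one_div, mul_comm]
      exact mul_le_mul_of_nonneg_right (inv_sq_le_exp (hy i)) (sq_nonneg _)
    rw [star_trivial, sub_mulVec, dotProduct_sub, smul_mulVec, one_mulVec, dotProduct_smul,
      smul_eq_mul, dotProduct_dualHess_mulVec]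
    linarith [mul_le_mul_of_nonneg_left hsum hn.le]
end
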